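/- Let X1, X2, X3 be finitely-valued random variables and let ρ0, ρ', ρ be nonnegative reals satisfying ρ0 + 3ρ' + 3ρ = H(X1,X2,X3), H(Xi,Xj) ≤ ρ0 + 3ρ' + 2ρ for all i ≠ j in {1,2,3}, and H(Xi) ≤ ρ0 + 2ρ' + ρ for all i ∈ {1,2,3}. Define R_MR(M) on [0, H(X1,X2,X3)] by: R_MR(M) = ρ0 + 3ρ' + 2ρ − 2M for M ∈ [0, (1/2)ρ'); R_MR(M) = ρ0 + (5/2)ρ' + 2ρ − M for M ∈ [(1/2)ρ', ρ0 + (3/2)(ρ'+ρ)); R_MR(M) = (2/3)ρ0 + 2ρ' + (3/2)ρ − (2/3)M for M ∈ [ρ0 + (3/2)(ρ'+ρ), ρ0 + 3ρ' + (3/2)ρ); R_MR(M) = (1/3)ρ0 + ρ' + ρ − (1/3)M for M ∈ [ρ0 + 3ρ' + (3/2)ρ, ρ0 + 3ρ' + 3ρ]. Define R_lb(M) = max{max_{i≠j} H(Xi,Xj) − 2M, (1/2)(max_{i≠j} H(Xi,Xj) − M), (1/3)(H(X1,X2,X3) − M), (1/2)(H(X1,X2,X3) + max_i H(Xi)) −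 M}, and let Γ = min{H(X2,X3|X1), H(X1,X3|X2), H(X1,X2|X3)}. Then: (a) R_MR(M) − R_lb(M) ≤ (1/2)Γ − ρ for all M ∈ [0, ρ0 + (3/2)(ρ'+ρ)); (b) R_MR(M) − R_lb(M) ≤ (1/4)Γ − (1/2)ρ for all M ∈ [ρ0 + (3/2)(ρ'+ρ), ρ0 + 3ρ' + (3/2)ρ); (c) R_MR(M) ≤ R_lb(M) for all M ∈ [ρ0 + 3ρ' + (3/2)ρ, H(X1,X2,X3)]. -/

import Mathlib

open Real

/-- Distribution (pmf) of the random variable `X` under the pmf `p` on the sample space. -/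
noncomputable def distOf {Ω A : Type*} [Fintype Ω] [DecidableEq A]
    (p : Ω → ℝ) (X : Ω → A) (a : A) : ℝ :=
  ∑ ω ∈ Finset.univ.filter (fun ω => X ω = a), p ω

/-- Shannon entropy of the random variable `X` under the pmf `p`. -/
noncomputable def ent {Ω A : Type*} [Fintype Ω] [Fintype A] [DecidableEq A]
    (p : Ω → ℝ) (X : Ω → A) : ℝ :=
  ∑ a, Real.negMulLog (distOf p X a)

/-- Conditional entropy `H(X | Y) = H(X, Y) - H(Y)`. -/
noncomputable def condEnt {Ω A B : Type*} [Fintype Ω] [Fintype A] [Fintype B]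
    [DecidableEq A] [DecidableEq B] (p : Ω → ℝ) (X : Ω → A) (Y : Ω → B) : ℝ :=
  ent p (fun ω => (X ω, Y ω)) - ent p Y

/-- Mutual information `I(X; Y) = H(X) + H(Y) - H(X, Y)`. -/
noncomputable def mutInfo {Ω A B : Type*} [Fintype Ω] [Fintype A] [Fintype B]
    [DecidableEq A] [DecidableEq B] (p : Ω → ℝ) (X : Ω → A) (Y : Ω → B) : ℝ :=
  ent p X + ent p Y - ent p (fun ω => (X ω, Y ω))

/-- `p` is a probability mass function. -/
def IsPMF {Ω : Type*} [Fintype Ω] (p : Ω → ℝ) : Prop :=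
  (∀ ω, 0 ≤ p ω) ∧ ∑ ω, p ω = 1

/-- `X1 − U − X2` is a Markov chain: `X1` and `X2` are conditionally independent given `U`. -/
def MarkovTriple {Ω A B C : Type*} [Fintype Ω] [DecidableEq A] [DecidableEq B] [DecidableEq C]
    (p : Ω → ℝ) (X1 : Ω → A) (X2 : Ω → B) (U : Ω → C) : Prop :=
  ∀ x1 x2 u,
    distOf p (fun ω => (X1 ω, X2 ω, U ω)) (x1, x2, u) * distOf p U u =
    distOf p (fun ω => (X1 ω, U ω)) (x1, u) * distOf p (fun ω => (X2 ω, U ω)) (x2, u)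

section EntropyLemmas

variable {Ω A B C : Type*} [Fintype Ω]

lemma distOf_nonneg [DecidableEq A] {p : Ω → ℝ} (hp : ∀ ω, 0 ≤ p ω) (X : Ω → A) (a : A) :
    0 ≤ distOf p X a :=
  Finset.sum_nonneg fun ω _ => hp ω

lemma le_distOf_self [DecidableEq A] {p : Ω → ℝ} (hp : ∀ ω, 0 ≤ p ω) (X : Ω → A) (ω : Ω) :
    p ω ≤ distOf p X (X ω) :=
  Finset.single_le_sum (f := p) (fun i _ => hp i) (by simp)

lemma sum_mul_comp_eq_sum_distOf [Fintype A] [DecidableEq A] (p : Ω → ℝ) (X : Ω → A)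
    (g : A → ℝ) : ∑ ω, p ω * g (X ω) = ∑ a, distOf p X a * g a := by
  rw [← Finset.sum_fiberwise Finset.univ X]
  refine Finset.sum_congr rfl fun a _ => ?_
  rw [distOf, Finset.sum_mul]
  refine Finset.sum_congr rfl fun ω hω => ?_
  rw [(Finset.mem_filter.1 hω).2]

lemma sum_distOf [Fintype A] [DecidableEq A] (p : Ω → ℝ) (X : Ω → A) :
    ∑ a, distOf p X a = ∑ ω, p ω := by
  simpa using (sum_mul_comp_eq_sum_distOf p X fun _ => 1).symm

lemma sum_distOf_pair [DecidableEq A] [Fintype B] [DecidableEq B] (p : Ω → ℝ) (X : Ω → A)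
    (Y : Ω → B) (a : A) : ∑ b, distOf p (fun ω => (X ω, Y ω)) (a, b) = distOf p X a := by
  unfold distOf
  rw [← Finset.sum_fiberwise (Finset.univ.filter fun ω => X ω = a) Y]
  simp [Finset.filter_filter]

lemma ent_eq_neg_sum_mul_log [Fintype A] [DecidableEq A] (p : Ω → ℝ) (X : Ω → A) :
    ent p X = -∑ ω, p ω * log (distOf p X (X ω)) := by
  rw [sum_mul_comp_eq_sum_distOf p X fun a => log (distOf p X a), ent, ← Finset.sum_neg_distrib]
  simp [negMulLog]

lemma ent_comp_of_injective [Fintype A] [DecidableEq A] [Fintype B] [DecidableEq B]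
    (p : Ω → ℝ) (X : Ω → A) {f : A → B} (hf : f.Injective) :
    ent p (fun ω => f (X ω)) = ent p X := by
  simp [ent_eq_neg_sum_mul_log, distOf, hf.eq_iff]

/-- Submodularity of entropy: `H(X, Y, Z) + H(X) ≤ H(X, Y) + H(X, Z)`. -/
lemma ent_submodular [Fintype A] [DecidableEq A] [Fintype B] [DecidableEq B]
    [Fintype C] [DecidableEq C] {p : Ω → ℝ} (hp : ∀ ω, 0 ≤ p ω)
    (X : Ω → A) (Y : Ω → B) (Z : Ω → C) :
    ent p (fun ω => (X ω, Y ω, Z ω)) + ent p X ≤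
      ent p (fun ω => (X ω, Y ω)) + ent p (fun ω => (X ω, Z ω)) := by
  set r := distOf p (fun ω => (X ω, Y ω, Z ω)) with hr
  set s := distOf p (fun ω => (X ω, Y ω)) with hs
  set t := distOf p (fun ω => (X ω, Z ω)) with ht
  set q := distOf p X with hq
  have hs0 : ∀ x, 0 ≤ s x := distOf_nonneg hp _
  have ht0 : ∀ x, 0 ≤ t x := distOf_nonneg hp _
  have hr0 : ∀ x, 0 ≤ r x := distOf_nonneg hp _
  have hq0 : ∀ x, 0 ≤ q x := distOf_nonneg hp _
  let g : A × B × C → ℝ := fun x => s (x.1, x.2.1) * t (x.1, x.2.2) / (r x * q x.1)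
  have hpt : ∀ ω, p ω * (log (s (X ω, Y ω)) + log (t (X ω, Z ω)) - log (r (X ω, Y ω, Z ω))
      - log (q (X ω))) ≤ p ω * g (X ω, Y ω, Z ω) - p ω := by
    intro ω
    rcases (hp ω).eq_or_lt with h | h
    · simp [← h]
    have h1 : 0 < s (X ω, Y ω) := h.trans_le (le_distOf_self hp (fun ω => (X ω, Y ω)) ω)
    have h2 : 0 < t (X ω, Z ω) := h.trans_le (le_distOf_self hp (fun ω => (X ω, Z ω)) ω)
    have h3 : 0 < r (X ω, Y ω, Z ω) :=
      h.trans_le (le_distOf_self hp (fun ω => (X ω, Y ω, Z ω)) ω)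
    have h4 : 0 < q (X ω) := h.trans_le (le_distOf_self hp X ω)
    have h5 : 0 < g (X ω, Y ω, Z ω) := by positivity
    have h6 : log (g (X ω, Y ω, Z ω)) = log (s (X ω, Y ω)) + log (t (X ω, Z ω))
        - log (r (X ω, Y ω, Z ω)) - log (q (X ω)) := by
      simp only [g]
      rw [log_div (by positivity) (by positivity), log_mul h1.ne' h2.ne', log_mul h3.ne' h4.ne']
      ring
    rw [← h6, ← mul_sub_one]
    exact mul_le_mul_of_nonneg_left (log_le_sub_one_of_pos h5) h.le
  have hg : ∑ ω, p ω * g (X ω, Y ω, Z ω) ≤ ∑ ω, p ω := by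
    calc ∑ ω, p ω * g (X ω, Y ω, Z ω) = ∑ x, r x * g x :=
          sum_mul_comp_eq_sum_distOf p (fun ω => (X ω, Y ω, Z ω)) g
      _ ≤ ∑ x : A × B × C, s (x.1, x.2.1) * t (x.1, x.2.2) / q x.1 := by
          refine Finset.sum_le_sum fun x _ => ?_
          rcases (hr0 x).eq_or_lt with h | h
          · rw [← h, zero_mul]
            exact div_nonneg (mul_nonneg (hs0 _) (ht0 _)) (hq0 _)
          · refine le_of_eq ?_
            simp only [g]
            rw [← mul_div_assoc, mul_div_mul_left _ _ h.ne']
      _ = ∑ a, q a := by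
          rw [Fintype.sum_prod_type]
          refine Finset.sum_congr rfl fun a _ => ?_
          dsimp only
          rw [← Finset.sum_div, Fintype.sum_prod_type]
          simp only [← Finset.mul_sum, ← Finset.sum_mul]
          rw [hs, ht, sum_distOf_pair, sum_distOf_pair, ← hq, mul_self_div_self]
      _ = ∑ ω, p ω := sum_distOf p X
  have hsum := Finset.sum_le_sum fun ω (_ : ω ∈ Finset.univ) => hpt ω
  simp only [mul_sub, mul_add, Finset.sum_sub_distrib, Finset.sum_add_distrib] at hsum
  simp only [ent_eq_neg_sum_mul_log, ← hr, ← hs, ← ht, ← hq]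
  linarith

end EntropyLemmas

theorem stmt18 {Ω A B C : Type*} [Fintype Ω] [Fintype A] [Fintype B] [Fintype C]
    [DecidableEq A] [DecidableEq B] [DecidableEq C]
    (p : Ω → ℝ) (hp : IsPMF p)
    (X1 : Ω → A) (X2 : Ω → B) (X3 : Ω → C)
    (ρ0 ρ' ρ : ℝ) (hρ0 : 0 ≤ ρ0) (hρ' : 0 ≤ ρ') (hρ : 0 ≤ ρ)
    (hsum : ρ0 + 3*ρ' + 3*ρ = ent p (fun ω => (X1 ω, X2 ω, X3 ω)))
    (h12 : ent p (fun ω => (X1 ω, X2 ω)) ≤ ρ0 + 3*ρ' + 2*ρ)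
    (h13 : ent p (fun ω => (X1 ω, X3 ω)) ≤ ρ0 + 3*ρ' + 2*ρ)
    (h23 : ent p (fun ω => (X2 ω, X3 ω)) ≤ ρ0 + 3*ρ' + 2*ρ)
    (h1 : ent p X1 ≤ ρ0 + 2*ρ' + ρ)
    (h2 : ent p X2 ≤ ρ0 + 2*ρ' + ρ)
    (h3 : ent p X3 ≤ ρ0 + 2*ρ' + ρ)
    (RMR Rlb : ℝ → ℝ)
    (hRMR : ∀ M, RMR M =
      if M < (1/2) * ρ' then ρ0 + 3 * ρ' + 2 * ρ - 2 * M
      else if M < ρ0 + (3/2) * (ρ' + ρ) then ρ0 + (5/2) * ρ' + 2 * ρ - M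
      else if M < ρ0 + 3 * ρ' + (3/2) * ρ then (2/3) * ρ0 + 2 * ρ' + (3/2) * ρ - (2/3) * M
      else (1/3) * ρ0 + ρ' + ρ - (1/3) * M)
    (hRlb : ∀ M, Rlb M =
      max (max (ent p (fun ω => (X1 ω, X2 ω)))
            (max (ent p (fun ω => (X1 ω, X3 ω))) (ent p (fun ω => (X2 ω, X3 ω)))) - 2 * M)
        (max ((1/2) * (max (ent p (fun ω => (X1 ω, X2 ω)))
              (max (ent p (fun ω => (X1 ω, X3 ω))) (ent p (fun ω => (X2 ω, X3 ω)))) - M))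
          (max ((1/3) * (ent p (fun ω => (X1 ω, X2 ω, X3 ω)) - M))
               ((1/2) * (ent p (fun ω => (X1 ω, X2 ω, X3 ω))
                  + max (ent p X1) (max (ent p X2) (ent p X3))) - M))))
    (Γ : ℝ)
    (hΓ : Γ = min (condEnt p (fun ω => (X2 ω, X3 ω)) X1)
            (min (condEnt p (fun ω => (X1 ω, X3 ω)) X2)
                 (condEnt p (fun ω => (X1 ω, X2 ω)) X3))) :
    (∀ M ∈ Set.Ico (0:ℝ) (ρ0 + (3/2) * (ρ' + ρ)),
      RMR M - Rlb M ≤ (1/2) * Γ - ρ) ∧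
    (∀ M ∈ Set.Ico (ρ0 + (3/2) * (ρ' + ρ)) (ρ0 + 3 * ρ' + (3/2) * ρ),
      RMR M - Rlb M ≤ (1/4) * Γ - (1/2) * ρ) ∧
    (∀ M ∈ Set.Icc (ρ0 + 3 * ρ' + (3/2) * ρ) (ent p (fun ω => (X1 ω, X2 ω, X3 ω))),
      RMR M ≤ Rlb M) := by
  have e1 : ent p (fun ω => ((X2 ω, X3 ω), X1 ω)) = ent p (fun ω => (X1 ω, X2 ω, X3 ω)) :=
    ent_comp_of_injective p (fun ω => (X1 ω, X2 ω, X3 ω)) (f := fun x => ((x.2.1, x.2.2), x.1))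
      (by rintro ⟨a, b, c⟩ ⟨a', b', c'⟩ h; simp_all)
  have e2 : ent p (fun ω => ((X1 ω, X3 ω), X2 ω)) = ent p (fun ω => (X1 ω, X2 ω, X3 ω)) :=
    ent_comp_of_injective p (fun ω => (X1 ω, X2 ω, X3 ω)) (f := fun x => ((x.1, x.2.2), x.2.1))
      (by rintro ⟨a, b, c⟩ ⟨a', b', c'⟩ h; simp_all)
  have e3 : ent p (fun ω => ((X1 ω, X2 ω), X3 ω)) = ent p (fun ω => (X1 ω, X2 ω, X3 ω)) :=
    ent_comp_of_injective p (fun ω => (X1 ω, X2 ω, X3 ω)) (f := fun x => ((x.1, x.2.1), x.2.2))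
      (by rintro ⟨a, b, c⟩ ⟨a', b', c'⟩ h; simp_all)
  have e4 : ent p (fun ω => (X2 ω, X1 ω, X3 ω)) = ent p (fun ω => (X1 ω, X2 ω, X3 ω)) :=
    ent_comp_of_injective p (fun ω => (X1 ω, X2 ω, X3 ω)) (f := fun x => (x.2.1, x.1, x.2.2))
      (by rintro ⟨a, b, c⟩ ⟨a', b', c'⟩ h; simp_all)
  have e5 : ent p (fun ω => (X3 ω, X1 ω, X2 ω)) = ent p (fun ω => (X1 ω, X2 ω, X3 ω)) :=
    ent_comp_of_injective p (fun ω => (X1 ω, X2 ω, X3 ω)) (f := fun x => (x.2.2, x.1, x.2.1))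
      (by rintro ⟨a, b, c⟩ ⟨a', b', c'⟩ h; simp_all)
  have e21 : ent p (fun ω => (X2 ω, X1 ω)) = ent p (fun ω => (X1 ω, X2 ω)) :=
    ent_comp_of_injective p (fun ω => (X1 ω, X2 ω)) (f := Prod.swap)
      Prod.swap_injective
  have e31 : ent p (fun ω => (X3 ω, X1 ω)) = ent p (fun ω => (X1 ω, X3 ω)) :=
    ent_comp_of_injective p (fun ω => (X1 ω, X3 ω)) (f := Prod.swap)
      Prod.swap_injective
  have e32 : ent p (fun ω => (X3 ω, X2 ω)) = ent p (fun ω => (X2 ω, X3 ω)) :=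
    ent_comp_of_injective p (fun ω => (X2 ω, X3 ω)) (f := Prod.swap)
      Prod.swap_injective
  have s1 := ent_submodular hp.1 X1 X2 X3
  have s2 := ent_submodular hp.1 X2 X1 X3
  have s3 := ent_submodular hp.1 X3 X1 X2
  rw [e4, e21] at s2
  rw [e5, e31, e32] at s3
  simp only [condEnt, e1, e2, e3, min_sub_sub_left] at hΓ
  set S := ent p (fun ω => (X1 ω, X2 ω, X3 ω))
  set P := max (ent p (fun ω => (X1 ω, X2 ω)))
    (max (ent p (fun ω => (X1 ω, X3 ω))) (ent p (fun ω => (X2 ω, X3 ω))))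
  set Q := max (ent p X1) (max (ent p X2) (ent p X3))
  have p12 : ent p (fun ω => (X1 ω, X2 ω)) ≤ P := le_max_left _ _
  have p13 : ent p (fun ω => (X1 ω, X3 ω)) ≤ P := (le_max_left _ _).trans (le_max_right _ _)
  have p23 : ent p (fun ω => (X2 ω, X3 ω)) ≤ P := (le_max_right _ _).trans (le_max_right _ _)
  have hQP : Q ≤ 2 * P - S :=
    max_le (by linarith) (max_le (by linarith) (by linarith))
  have lb1 : ∀ M, P - 2 * M ≤ Rlb M := fun M => by
    rw [hRlb]; exact le_max_left _ _
  have lb3 : ∀ M, 1 / 3 * (S - M) ≤ Rlb M := fun M => by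
    rw [hRlb]; exact (le_max_left _ _).trans ((le_max_right _ _).trans (le_max_right _ _))
  have lb4 : ∀ M, 1 / 2 * (S + Q) - M ≤ Rlb M := fun M => by
    rw [hRlb]; exact (le_max_right _ _).trans ((le_max_right _ _).trans (le_max_right _ _))
  refine ⟨fun M hM => ?_, fun M hM => ?_, fun M hM => ?_⟩ <;>
  · obtain ⟨hM1, hM2⟩ := hM
    have b1 := lb1 M
    have b3 := lb3 M
    have b4 := lb4 M
    rw [hRMR]
    split_ifs <;> linarith
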